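/- (Inequality (p120) in the proof of Theorem A(b)) Let u be a weak stationary solution density and let U be a Lyapunov function in 𝒰 with respect to ℒ with Lyapunov constant γ > 0, essential lower bound ρ_m and essential upper bound ρ_M. Let H be an upper sandwich function for U. Suppose ρ_m < η < η* < ρ_M and ∇U(x) ≠ 0 for every x ∈ U^{-1}(η) ∪ U^{-1}(η*). Then γ · μ(Ω_{η*} \ Ω_η) ≤ H(η) · ∫_{U^{-1}(η)} u(x)/|∇U(x)| dℋ^{n−1}(x), where ℋ^{n−1} is the (n−1)-dimensional Hausdorff measure. -/

import Mathlib

open MeasureTheory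

noncomputable section

/-- Euclidean space ℝⁿ. -/
abbrev Eucl (n : ℕ) : Type := EuclideanSpace ℝ (Fin n)

/-- First-order partial derivative `∂ᵢ f`. -/
def pd {n : ℕ} (f : Eucl n → ℝ) (i : Fin n) (x : Eucl n) : ℝ :=
  fderiv ℝ f x (EuclideanSpace.single i 1)

/-- Second-order partial derivative `∂²ᵢⱼ f`. -/
def pd2 {n : ℕ} (f : Eucl n → ℝ) (i j : Fin n) (x : Eucl n) : ℝ :=
  fderiv ℝ (fun y => fderiv ℝ f y (EuclideanSpace.single j 1)) x (EuclideanSpace.single i 1)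

/-- The adjoint Fokker–Planck operator `ℒf = aⁱʲ ∂²ᵢⱼ f + Vⁱ ∂ᵢ f`. -/
def Lop {n : ℕ} (a : Eucl n → Matrix (Fin n) (Fin n) ℝ)
    (V : Eucl n → Fin n → ℝ) (f : Eucl n → ℝ) (x : Eucl n) : ℝ :=
  (∑ i, ∑ j, a x i j * pd2 f i j x) + ∑ i, V x i * pd f i x

/-- The quadratic form `⟨a(x) ∇f(x), ∇f(x)⟩ = ∑ᵢⱼ aⁱʲ ∂ᵢf ∂ⱼf`. -/
def aQuad {n : ℕ} (a : Eucl n → Matrix (Fin n) (Fin n) ℝ)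
    (f : Eucl n → ℝ) (x : Eucl n) : ℝ :=
  ∑ i, ∑ j, a x i j * pd f i x * pd f j x

open Set Filter Topology Metric
open scoped ENNReal NNReal

/-- Orthonormal coordinates adapted to a unit vector `e`: the first coordinate is `⟪e, ·⟫`, and the
remaining ones form a `1`-Lipschitz map. -/
theorem exists_adapted_coords {m : ℕ} (e : Eucl (m + 1)) (he : ‖e‖ = 1) :
    ∃ T : Eucl (m + 1) ≃ᵐ ℝ × (Fin m → ℝ), MeasurePreserving T ∧
      (∀ x, (T x).1 = inner ℝ e x) ∧
      LipschitzWith 1 (fun x => (T x).2) ∧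
      (∀ x y, (T x).2 = (T y).2 → y = x + (inner ℝ e y - inner ℝ e x) • e) ∧
      (∀ x (t : ℝ), (T (x + t • e)).2 = (T x).2) ∧
      ∀ x y, ‖x - y‖ ^ 2 ≤ (inner ℝ e (x - y)) ^ 2 + m * ‖(T x).2 - (T y).2‖ ^ 2 := by
  obtain ⟨b, hb⟩ : ∃ b : OrthonormalBasis (Fin (m + 1)) ℝ (Eucl (m + 1)), b 0 = e := by
    obtain ⟨b, hb⟩ := Orthonormal.exists_orthonormalBasis_extension_of_card_eq (𝕜 := ℝ)
      (E := Eucl (m + 1)) (ι := Fin (m + 1)) (by simp) (v := fun _ => e) (s := {0}) (by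
        constructor
        · intro i; simpa using he
        · intro i j hij
          exact absurd (Subsingleton.elim i j) hij)
    exact ⟨b, hb 0 rfl⟩
  let T : Eucl (m + 1) ≃ᵐ ℝ × (Fin m → ℝ) :=
    (b.measurableEquiv.trans (MeasurableEquiv.toLp 2 (Fin (m + 1) → ℝ)).symm).trans
      (MeasurableEquiv.piFinSuccAbove (fun _ => ℝ) 0)
  have hT1 : ∀ x, (T x).1 = inner ℝ e x := by
    intro x
    rw [← hb, ← b.repr_apply_apply]
    rfl
  have hT2 : ∀ x i, (T x).2 i = b.repr x i.succ := fun x i => rfl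
  have hnorm : ∀ x, ‖x‖ ^ 2 = (inner ℝ e x) ^ 2 + ∑ i : Fin m, (b.repr x i.succ) ^ 2 := by
    intro x
    rw [← b.repr.norm_map, EuclideanSpace.norm_sq_eq, Fin.sum_univ_succ]
    simp only [Real.norm_eq_abs, sq_abs]
    rw [b.repr_apply_apply x 0, hb]
  have hsingle : ∀ i : Fin m, b.repr e i.succ = 0 := by
    intro i
    rw [← hb]
    simp [b.repr_self]
  refine ⟨T, ?_, hT1, ?_, ?_, ?_, ?_⟩
  · exact (volume_preserving_piFinSuccAbove (fun _ : Fin (m + 1) => ℝ) 0).comp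
      ((EuclideanSpace.volume_preserving_symm_measurableEquiv_toLp (Fin (m + 1))).comp
        b.measurePreserving_measurableEquiv)
  · refine LipschitzWith.of_dist_le_mul fun x y => ?_
    rw [NNReal.coe_one, one_mul, dist_pi_le_iff dist_nonneg]
    intro i
    rw [hT2, hT2, dist_eq_norm, dist_eq_norm]
    have := PiLp.norm_apply_le (b.repr (x - y)) i.succ
    rw [b.repr.norm_map, map_sub] at this
    exact this
  · intro x y h
    have : b.repr y = b.repr (x + (inner ℝ e y - inner ℝ e x) • e) := by
      ext i
      refine Fin.cases ?_ (fun j => ?_) i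
      · rw [b.repr_apply_apply, b.repr_apply_apply, hb, inner_add_right, inner_smul_right,
          real_inner_self_eq_norm_sq, he]
        ring
      · have hj := congrFun h j
        rw [hT2, hT2] at hj
        simp [hsingle, hj]
    exact b.repr.injective this
  · intro x t
    ext i
    rw [hT2, hT2]
    simp [hsingle]
  · intro x y
    rw [hnorm (x - y)]
    gcongr
    calc ∑ i : Fin m, (b.repr (x - y) i.succ) ^ 2
        ≤ ∑ _i : Fin m, ‖(T x).2 - (T y).2‖ ^ 2 := by
          refine Finset.sum_le_sum fun i _ => ?_
          have := norm_le_pi_norm ((T x).2 - (T y).2) i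
          rw [Pi.sub_apply, hT2, hT2, Real.norm_eq_abs] at this
          rw [← sq_abs, map_sub]
          exact pow_le_pow_left₀ (abs_nonneg _) this 2
      _ = m * ‖(T x).2 - (T y).2‖ ^ 2 := by simp

/-- A measurable set whose fibres in direction `e` have length at most `c` has volume at most `c`
times the Hausdorff measure of any set having the same projection. -/
theorem volume_le_mul_hausdorffMeasure {m : ℕ} (e : Eucl (m + 1)) (he : ‖e‖ = 1)
    {A S : Set (Eucl (m + 1))} (hA : MeasurableSet A) (c : ℝ)
    (hfib : ∀ x ∈ A, ∀ t : ℝ, 0 ≤ t → x + t • e ∈ A → t ≤ c)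
    (hproj : ∀ x ∈ A, ∃ t : ℝ, x + t • e ∈ S) :
    volume A ≤ ENNReal.ofReal c * μH[(m : ℝ)] S := by
  obtain ⟨T, hT, hT1, hTL, hTf, hTs, -⟩ := exists_adapted_coords e he
  set P := fun x => (T x).2 with hP
  have hS : volume (P '' S) ≤ μH[(m : ℝ)] S := by
    have h := hTL.hausdorffMeasure_image_le (d := (m : ℝ)) (Nat.cast_nonneg m) S
    have h2 : (volume : Measure (Fin m → ℝ)) = μH[(m : ℝ)] := by
      rw [← hausdorffMeasure_pi_real, Fintype.card_fin]
    rw [h2]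
    simpa using h
  have hTA : MeasurableSet (T '' A) := T.measurableSet_image.2 hA
  have hvol : volume A = volume (T '' A) := by
    rw [← hT.measure_preimage hTA.nullMeasurableSet, preimage_image_eq _ T.injective]
  set B := toMeasurable volume (P '' S) with hB
  have hle : ∀ y, volume ((fun s => (s, y)) ⁻¹' (T '' A)) ≤
      B.indicator (fun _ => ENNReal.ofReal c) y := by
    intro y
    rcases ((fun s => (s, y)) ⁻¹' (T '' A)).eq_empty_or_nonempty with h0 | ⟨s0, x0, hx0, hx0s⟩
    · simp [h0]
    have hyB : y ∈ B := by
      obtain ⟨t, ht⟩ := hproj x0 hx0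
      refine subset_toMeasurable _ _ ⟨_, ht, ?_⟩
      rw [hP]
      simp only [hTs, hx0s]
    rw [indicator_of_mem hyB]
    refine (Real.volume_le_diam _).trans ?_
    refine ediam_le fun s1 h1 s2 h2 => ?_
    obtain ⟨x1, hx1, hx1s⟩ := h1
    obtain ⟨x2, hx2, hx2s⟩ := h2
    have key : ∀ a1 a2 : Eucl (m + 1), ∀ r1 r2 : ℝ, a1 ∈ A → a2 ∈ A → T a1 = (r1, y) →
        T a2 = (r2, y) → r1 ≤ r2 → r2 - r1 ≤ c := by
      intro a1 a2 r1 r2 ha1 ha2 e1 e2 h12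
      have := hTf a1 a2 (by rw [e1, e2])
      rw [← hT1, ← hT1, e1, e2] at this
      exact hfib a1 ha1 _ (by simpa using h12) (this ▸ ha2)
    rw [edist_dist, Real.dist_eq]
    refine ENNReal.ofReal_le_ofReal ?_
    rcases le_total s1 s2 with h | h
    · rw [abs_sub_comm, abs_of_nonneg (by linarith)]
      exact key x1 x2 s1 s2 hx1 hx2 hx1s hx2s h
    · rw [abs_of_nonneg (by linarith)]
      exact key x2 x1 s2 s1 hx2 hx1 hx2s hx1s h
  calc volume A = ∫⁻ y, volume ((fun s => (s, y)) ⁻¹' (T '' A)) := by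
        rw [hvol]; exact Measure.prod_apply_symm hTA
    _ ≤ ∫⁻ y, B.indicator (fun _ => ENNReal.ofReal c) y := lintegral_mono hle
    _ = ENNReal.ofReal c * volume (P '' S) := by
        rw [lintegral_indicator_const (measurableSet_toMeasurable _ _), measure_toMeasurable]
    _ ≤ _ := by gcongr

/-- `U` is `δ`-close to its linear part with gradient `v` on `s`, relative to `‖v‖`. -/
def NearlyLinearOn {n : ℕ} (U : Eucl n → ℝ) (v : Eucl n) (δ : ℝ) (s : Set (Eucl n)) : Prop :=
  ∀ x ∈ s, ∀ y ∈ s, |U y - U x - inner ℝ v (y - x)| ≤ δ * ‖v‖ * ‖y - x‖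

theorem NearlyLinearOn.mul_le_sub {n : ℕ} {U : Eucl n → ℝ} {v : Eucl n} {δ : ℝ}
    {s : Set (Eucl n)} (h : NearlyLinearOn U v δ s) (hv : v ≠ 0) {x : Eucl n} {t : ℝ}
    (ht : 0 ≤ t) (hx : x ∈ s) (hxt : x + t • (‖v‖⁻¹ • v) ∈ s) :
    (1 - δ) * ‖v‖ * t ≤ U (x + t • (‖v‖⁻¹ • v)) - U x := by
  have hv' : ‖v‖ ≠ 0 := norm_ne_zero_iff.2 hv
  have h1 := h x hx _ hxt
  have h2 : inner ℝ v (t • (‖v‖⁻¹ • v)) = t * ‖v‖ := by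
    rw [inner_smul_right, inner_smul_right, real_inner_self_eq_norm_sq]
    field_simp
  have h3 : ‖t • (‖v‖⁻¹ • v)‖ = t := by
    rw [norm_smul, norm_smul, norm_inv, norm_norm, inv_mul_cancel₀ hv', mul_one,
      Real.norm_of_nonneg ht]
  rw [add_sub_cancel_left, h2, h3] at h1
  have := (abs_le.1 h1).1
  linarith

/-- The part of the slab `η - ε ≤ U ≤ η` in a set `A` near a regular point has volume controlled by
the Hausdorff measure of the level set near `A`. -/
theorem NearlyLinearOn.volume_slab_le {m : ℕ} {U : Eucl (m + 1) → ℝ} {v p : Eucl (m + 1)}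
    {δ r η ε : ℝ} (h : NearlyLinearOn U v δ (ball p (2 * r))) (hv : v ≠ 0) (hδ : δ < 1)
    (hcont : ContinuousOn U (ball p (2 * r))) (hε : 0 < ε) (hεr : ε / ((1 - δ) * ‖v‖) < r)
    {A : Set (Eucl (m + 1))} (hA : MeasurableSet A) (hAr : A ⊆ ball p r)
    (hAU : ∀ x ∈ A, η - ε ≤ U x ∧ U x ≤ η) :
    volume A ≤ ENNReal.ofReal (ε / ((1 - δ) * ‖v‖)) *
      μH[(m : ℝ)] ({x ∈ ball p (2 * r) | U x = η} ∩ cthickening (ε / ((1 - δ) * ‖v‖)) A) := by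
  have hv' : 0 < ‖v‖ := norm_pos_iff.2 hv
  have hm : 0 < (1 - δ) * ‖v‖ := mul_pos (by linarith) hv'
  set c := ε / ((1 - δ) * ‖v‖) with hc
  have hc0 : 0 < c := div_pos hε hm
  have hr0 : 0 < r := hc0.trans hεr
  have hcm : (1 - δ) * ‖v‖ * c = ε := mul_div_cancel₀ _ hm.ne'
  set e := ‖v‖⁻¹ • v with he
  have hen : ‖e‖ = 1 := norm_smul_inv_norm hv
  have hbb : ball p r ⊆ ball p (2 * r) := ball_subset_ball (by linarith)
  refine volume_le_mul_hausdorffMeasure e hen hA c ?_ ?_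
  · intro x hx t ht hxt
    have := h.mul_le_sub hv ht (hbb (hAr hx)) (hbb (hAr hxt))
    have h1 := (hAU x hx).1
    have h2 := (hAU _ hxt).2
    rw [he] at h2
    rw [hc, le_div_iff₀ hm]
    linarith
  · intro x hx
    have hmem : ∀ t ∈ Icc 0 c, x + t • e ∈ ball p (2 * r) := by
      intro t ht
      have h1 : dist (x + t • e) x = t := by
        rw [dist_eq_norm, add_sub_cancel_left, norm_smul, hen, mul_one, Real.norm_of_nonneg ht.1]
      have h2 := mem_ball.1 (hAr hx)
      rw [mem_ball]
      have := dist_triangle (x + t • e) x p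
      linarith [ht.2]
    have hline : ContinuousOn (fun t : ℝ => U (x + t • e)) (Icc 0 c) :=
      hcont.comp (by fun_prop) hmem
    have hx0 := h.mul_le_sub hv hc0.le (hbb (hAr hx)) (hmem c ⟨hc0.le, le_rfl⟩)
    rw [hcm] at hx0
    obtain ⟨t, ht, hUt⟩ := intermediate_value_Icc hc0.le hline
      (show η ∈ Icc (U (x + (0 : ℝ) • e)) (U (x + c • e)) from
        ⟨by simpa using (hAU x hx).2, by linarith [(hAU x hx).1]⟩)
    refine ⟨t, ⟨hmem t ht, hUt⟩, ?_⟩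
    refine mem_cthickening_of_dist_le _ x _ _ hx ?_
    rw [dist_eq_norm, add_sub_cancel_left, norm_smul, hen, mul_one, Real.norm_of_nonneg ht.1]
    exact ht.2

/-- Near a regular point, the level set has finite Hausdorff measure. -/
theorem NearlyLinearOn.hausdorffMeasure_level_lt_top {m : ℕ} {U : Eucl (m + 1) → ℝ}
    {v p : Eucl (m + 1)} {δ r η : ℝ} (h : NearlyLinearOn U v δ (ball p r)) (hv : v ≠ 0)
    (hδ0 : 0 ≤ δ) (hδ : δ < 1) :
    μH[(m : ℝ)] {x ∈ ball p r | U x = η} < ⊤ := by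
  have hv' : 0 < ‖v‖ := norm_pos_iff.2 hv
  set e := ‖v‖⁻¹ • v with he
  have hen : ‖e‖ = 1 := norm_smul_inv_norm hv
  obtain ⟨T, -, -, hTL, -, -, hTn⟩ := exists_adapted_coords e hen
  set P := fun x => (T x).2 with hP
  set S := {x ∈ ball p r | U x = η} with hS
  have hδ2 : 0 < 1 - δ ^ 2 := by nlinarith
  set K := Real.sqrt (m / (1 - δ ^ 2)) with hK
  have hanti : ∀ x ∈ S, ∀ y ∈ S, ‖x - y‖ ≤ K * ‖P x - P y‖ := by
    intro x hx y hy
    have h1 := h y hy.1 x hx.1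
    rw [hx.2, hy.2, sub_self, zero_sub, abs_neg] at h1
    have h2 : inner ℝ v (x - y) = ‖v‖ * inner ℝ e (x - y) := by
      rw [he, inner_smul_left]
      simp only [RCLike.conj_to_real]
      field_simp
    rw [h2, abs_mul, abs_of_pos hv'] at h1
    have h3 : |inner ℝ e (x - y)| ≤ δ * ‖x - y‖ := by
      refine le_of_mul_le_mul_left ?_ hv'
      linarith
    have h4 := hTn x y
    have h5 : (inner ℝ e (x - y)) ^ 2 ≤ δ ^ 2 * ‖x - y‖ ^ 2 := by
      rw [← sq_abs, ← mul_pow]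
      exact pow_le_pow_left₀ (abs_nonneg _) h3 2
    have h6 : ‖x - y‖ ^ 2 ≤ m / (1 - δ ^ 2) * ‖P x - P y‖ ^ 2 := by
      rw [div_mul_eq_mul_div, le_div_iff₀ hδ2]
      simp only [hP]
      linarith
    have hK2 : K ^ 2 = m / (1 - δ ^ 2) := Real.sq_sqrt (by positivity)
    rw [← hK2, ← mul_pow] at h6
    exact le_of_sq_le_sq h6 (by positivity)
  have hinj : InjOn P S := by
    intro x hx y hy hxy
    have := hanti x hx y hy
    rw [hxy, sub_self, norm_zero, mul_zero] at this
    exact sub_eq_zero.1 (norm_le_zero_iff.1 this)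
  have hlip : LipschitzOnWith (Real.toNNReal K) (Function.invFunOn P S) (P '' S) := by
    refine LipschitzOnWith.of_dist_le_mul ?_
    rintro _ ⟨x, hx, rfl⟩ _ ⟨y, hy, rfl⟩
    rw [hinj.leftInvOn_invFunOn hx, hinj.leftInvOn_invFunOn hy,
      Real.coe_toNNReal _ (Real.sqrt_nonneg _), dist_eq_norm, dist_eq_norm]
    exact hanti x hx y hy
  have himg := hlip.hausdorffMeasure_image_le (d := (m : ℝ)) (Nat.cast_nonneg m)
  rw [hinj.leftInvOn_invFunOn.image_image] at himg
  refine himg.trans_lt (ENNReal.mul_lt_top (by simp) ?_)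
  have h2 : (volume : Measure (Fin m → ℝ)) = μH[(m : ℝ)] := by
    rw [← hausdorffMeasure_pi_real, Fintype.card_fin]
  rw [← h2]
  exact (hTL.isBounded_image (isBounded_ball.subset (sep_subset _ _))).measure_lt_top

theorem integrableOn_of_continuousOn_isCompact {n : ℕ} {μ : Measure (Eucl n)} {g : Eucl n → ℝ}
    {K : Set (Eucl n)} (hg : ContinuousOn g K) (hK : IsCompact K) (hμ : μ K < ⊤) :
    IntegrableOn g K μ := by
  obtain ⟨C, hC⟩ := hK.exists_bound_of_continuousOn hg
  have : IsFiniteMeasure (μ.restrict K) := ⟨by rwa [Measure.restrict_apply_univ]⟩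
  refine Integrable.of_bound (hg.aestronglyMeasurable_of_isCompact hK hK.measurableSet) C ?_
  exact (ae_restrict_iff' hK.measurableSet).2 (Eventually.of_forall hC)

theorem continuousOn_gradient {n : ℕ} {𝒰 : Set (Eucl n)} (h𝒰 : IsOpen 𝒰) {U : Eucl n → ℝ}
    (hU : ContDiffOn ℝ 1 U 𝒰) : ContinuousOn (gradient U) 𝒰 :=
  (InnerProductSpace.toDual ℝ (Eucl n)).symm.continuous.comp_continuousOn
    (hU.continuousOn_fderiv_of_isOpen h𝒰 le_rfl)

theorem exists_nearlyLinearOn {n : ℕ} {U : Eucl n → ℝ} {p : Eucl n} (hU : ContDiffAt ℝ 1 U p)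
    (hp : gradient U p ≠ 0) {δ : ℝ} (hδ : 0 < δ) :
    ∃ R > 0, NearlyLinearOn U (gradient U p) δ (ball p R) := by
  have hs : HasStrictFDerivAt U (fderiv ℝ U p) p := hU.hasStrictFDerivAt one_ne_zero
  have hc : 0 < δ * ‖gradient U p‖ := mul_pos hδ (norm_pos_iff.2 hp)
  obtain ⟨s, hs1, hs2⟩ := hs.approximates_deriv_on_nhds
    (c := ⟨δ * ‖gradient U p‖, hc.le⟩) (Or.inr hc)
  obtain ⟨R, hR, hRs⟩ := Metric.mem_nhds_iff.1 hs1
  refine ⟨R, hR, fun x hx y hy => ?_⟩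
  have := hs2 y (hRs hy) x (hRs hx)
  rwa [← toDual_gradient, InnerProductSpace.toDual_apply_apply] at this

/-- A compact level set consisting of regular points has finite Hausdorff measure. -/
theorem hausdorffMeasure_level_lt_top {m : ℕ} {𝒰 : Set (Eucl (m + 1))} (h𝒰 : IsOpen 𝒰)
    {U : Eucl (m + 1) → ℝ} (hU : ContDiffOn ℝ 1 U 𝒰) {η : ℝ}
    (hS : IsCompact {x ∈ 𝒰 | U x = η}) (hreg : ∀ x ∈ 𝒰, U x = η → gradient U x ≠ 0) :
    μH[(m : ℝ)] {x ∈ 𝒰 | U x = η} < ⊤ := by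
  refine hS.measure_lt_top_of_nhdsWithin fun p hp => ?_
  obtain ⟨R, hR, hlin⟩ := exists_nearlyLinearOn (hU.contDiffAt (h𝒰.mem_nhds hp.1))
    (hreg p hp.1 hp.2) (show (0 : ℝ) < 1 / 2 by norm_num)
  refine ⟨{x ∈ ball p R | U x = η}, ?_, hlin.hausdorffMeasure_level_lt_top (hreg p hp.1 hp.2)
    (by norm_num) (by norm_num)⟩
  filter_upwards [self_mem_nhdsWithin, nhdsWithin_le_nhds (ball_mem_nhds p hR)] with x h1 h2
  exact ⟨h2, h1.2⟩

/-- Around a regular point of the level set `U = η` there is a ball with `ν`-null boundary on which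
slabs are controlled by the Hausdorff measure of the level set, with nearly sharp constant. -/
theorem exists_ball_slab_le {m : ℕ} {𝒰 : Set (Eucl (m + 1))} (h𝒰 : IsOpen 𝒰)
    {U : Eucl (m + 1) → ℝ} (hU : ContDiffOn ℝ 1 U 𝒰) {η : ℝ} {G : Eucl (m + 1) → ℝ}
    (hG : ContinuousOn G 𝒰) (hG0 : ∀ x ∈ 𝒰, 0 ≤ G x)
    (hS : IsCompact {x ∈ 𝒰 | U x = η}) (hreg : ∀ x ∈ 𝒰, U x = η → gradient U x ≠ 0)
    {κ : ℝ} (hκ : 0 < κ) {p : Eucl (m + 1)} (hp : p ∈ 𝒰) (hpη : U p = η) :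
    ∃ r > 0, ∃ c > 0, ∃ B ≥ 0, ball p r ⊆ 𝒰 ∧
      (μH[(m : ℝ)]).restrict {x ∈ 𝒰 | U x = η} (frontier (ball p r)) = 0 ∧
      (∀ x ∈ ball p r, G x ≤ B) ∧ (∀ x ∈ ball p r, B / c ≤ G x / ‖gradient U x‖ + κ) ∧
      ∀ ε > 0, ε / c < r → ∀ A, MeasurableSet A → A ⊆ ball p r →
        (∀ x ∈ A, η - ε ≤ U x ∧ U x ≤ η) →
        volume A ≤ ENNReal.ofReal (ε / c) *
          (μH[(m : ℝ)]).restrict {x ∈ 𝒰 | U x = η} (cthickening (ε / c) A) := by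
  set S := {x ∈ 𝒰 | U x = η} with hSdef
  have hfin := hausdorffMeasure_level_lt_top h𝒰 hU hS hreg
  have : IsFiniteMeasure ((μH[(m : ℝ)] : Measure (Eucl (m + 1))).restrict S) :=
    ⟨by rwa [Measure.restrict_apply_univ]⟩
  have hv := hreg p hp hpη
  have hv' : 0 < ‖gradient U p‖ := norm_pos_iff.2 hv
  have hpn := h𝒰.mem_nhds hp
  obtain ⟨δ, ⟨hδ0, hδ1⟩, hδ⟩ : ∃ δ, (0 < δ ∧ δ < 1) ∧
      (G p + δ) / ((1 - δ) * ‖gradient U p‖) < G p / ‖gradient U p‖ + κ / 2 := by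
    have hc : ContinuousAt (fun δ : ℝ => (G p + δ) / ((1 - δ) * ‖gradient U p‖)) 0 := by
      refine ContinuousAt.div (by fun_prop) (by fun_prop) ?_
      simpa using hv
    have h1 : ∀ᶠ δ : ℝ in 𝓝 0, (G p + δ) / ((1 - δ) * ‖gradient U p‖) <
        G p / ‖gradient U p‖ + κ / 2 := by
      refine hc.eventually_lt_const ?_
      simp only [add_zero, sub_zero, one_mul]
      linarith
    have h2 : ∀ᶠ δ : ℝ in 𝓝[>] 0, 0 < δ ∧ δ < 1 := Ioo_mem_nhdsGT one_pos
    obtain ⟨δ, h, h'⟩ := (h2.and (nhdsWithin_le_nhds h1)).exists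
    exact ⟨δ, h, h'⟩
  have hgc : ContinuousAt (fun x => G x / ‖gradient U x‖) p :=
    (hG.continuousAt hpn).div ((continuousOn_gradient h𝒰 hU).continuousAt hpn).norm hv'.ne'
  have e1 : ∀ᶠ x in 𝓝 p, G p / ‖gradient U p‖ - κ / 2 < G x / ‖gradient U x‖ :=
    hgc.eventually_const_lt (by linarith)
  have e2 : ∀ᶠ x in 𝓝 p, G x < G p + δ := (hG.continuousAt hpn).eventually_lt_const (by linarith)
  obtain ⟨R1, hR1, h1⟩ := Metric.eventually_nhds_iff_ball.1 ((e1.and e2).and hpn)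
  obtain ⟨R2, hR2, hlin⟩ := exists_nearlyLinearOn (hU.contDiffAt hpn) hv hδ0
  obtain ⟨r, ⟨hr0, hrR⟩, hnull⟩ := exists_null_frontier_thickening
    ((μH[(m : ℝ)] : Measure (Eucl (m + 1))).restrict S) {p}
    (show 0 < min R1 R2 / 2 by positivity)
  rw [thickening_singleton] at hnull
  have hrR1 : 2 * r ≤ R1 := by linarith [min_le_left R1 R2]
  have hrR2 : 2 * r ≤ R2 := by linarith [min_le_right R1 R2]
  have hsub : ball p (2 * r) ⊆ 𝒰 := fun x hx => (h1 x (ball_subset_ball hrR1 hx)).2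
  have hsub1 : ball p r ⊆ ball p R1 := ball_subset_ball (by linarith)
  refine ⟨r, hr0, (1 - δ) * ‖gradient U p‖, mul_pos (by linarith) hv', G p + δ,
    add_nonneg (hG0 p hp) hδ0.le, (ball_subset_ball (by linarith)).trans hsub, hnull,
    fun x hx => (h1 x (hsub1 hx)).1.2.le, fun x hx => ?_, ?_⟩
  · linarith [(h1 x (hsub1 hx)).1.1]
  · intro ε hε hεr A hA hAr hAU
    have hlin' : NearlyLinearOn U (gradient U p) δ (ball p (2 * r)) := fun x hx y hy =>
      hlin x (ball_subset_ball hrR2 hx) y (ball_subset_ball hrR2 hy)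
    refine (hlin'.volume_slab_le hv hδ1 (hU.continuousOn.mono hsub) hε hεr hA hAr hAU).trans ?_
    rw [Measure.restrict_apply isClosed_cthickening.measurableSet, inter_comm]
    gcongr
    exact fun x hx => ⟨hsub hx.1, hx.2⟩

theorem slab_isCompact {n : ℕ} {𝒰 : Set (Eucl n)} {U : Eucl n → ℝ} (hU : ContinuousOn U 𝒰)
    {η : ℝ} (hK : IsCompact {x ∈ 𝒰 | U x ≤ η}) (α : ℝ) :
    IsCompact {x ∈ 𝒰 | α ≤ U x ∧ U x ≤ η} := by
  have h := (hU.mono (sep_subset 𝒰 (fun x => U x ≤ η))).preimage_isClosed_of_isClosed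
    hK.isClosed (isClosed_Ici (a := α))
  convert hK.inter_right h using 1
  ext x
  simp only [mem_inter_iff, mem_ofPred_eq, mem_preimage, mem_Ici]
  tauto

/-- If slabs below the regular compact level `η` carry `G`-mass at least `ε * M`, then `M` is at
most the weighted Hausdorff integral of `G / ‖∇U‖` over the level set. -/
theorem le_setIntegral_level {m : ℕ} {𝒰 : Set (Eucl (m + 1))} (h𝒰 : IsOpen 𝒰)
    {U : Eucl (m + 1) → ℝ} (hU : ContDiffOn ℝ 1 U 𝒰) {η : ℝ} {G : Eucl (m + 1) → ℝ}
    (hG : ContinuousOn G 𝒰) (hG0 : ∀ x ∈ 𝒰, 0 ≤ G x)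
    (hK : IsCompact {x ∈ 𝒰 | U x ≤ η}) (hreg : ∀ x ∈ 𝒰, U x = η → gradient U x ≠ 0)
    {M : ℝ} (hM : ∀ᶠ ε in 𝓝[>] 0, ε * M ≤ ∫ x in {x ∈ 𝒰 | η - ε ≤ U x ∧ U x ≤ η}, G x) :
    M ≤ ∫ x in {x ∈ 𝒰 | U x = η}, G x / ‖gradient U x‖ ∂μH[(m : ℝ)] := by
  have hS : IsCompact {x ∈ 𝒰 | U x = η} := by
    convert slab_isCompact hU.continuousOn hK η using 1
    ext x
    simp only [mem_ofPred_eq]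
    exact and_congr_right fun _ => ⟨fun h => ⟨h.ge, h.le⟩, fun h => le_antisymm h.2 h.1⟩
  set S := {x ∈ 𝒰 | U x = η} with hSdef
  set ν := (μH[(m : ℝ)] : Measure (Eucl (m + 1))).restrict S with hν
  have hfin := hausdorffMeasure_level_lt_top h𝒰 hU hS hreg
  have : IsFiniteMeasure ν := ⟨by rwa [hν, Measure.restrict_apply_univ]⟩
  set g := fun x => G x / ‖gradient U x‖ with hg
  have hgS : ContinuousOn g S :=
    (hG.mono (sep_subset _ _)).div ((continuousOn_gradient h𝒰 hU).mono (sep_subset _ _)).norm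
      fun x hx => norm_ne_zero_iff.2 (hreg x hx.1 hx.2)
  have hgint : Integrable g ν :=
    integrableOn_of_continuousOn_isCompact hgS hS hfin
  have hνS : ∀ᵐ x ∂ν, x ∈ S := ae_restrict_mem hS.measurableSet
  refine le_of_forall_pos_le_add fun τ hτ => ?_
  obtain ⟨κ, hκ0, hκ⟩ : ∃ κ > 0, κ * ν.real univ + κ ≤ τ := by
    refine ⟨τ / (ν.real univ + 1), by positivity, le_of_eq ?_⟩
    field_simp
  have hgκ : Integrable (fun x => g x + κ) ν := hgint.add (integrable_const κ)
  set slab := fun ε : ℝ => {x ∈ 𝒰 | η - ε ≤ U x ∧ U x ≤ η} with hslab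
  have hslabc : ∀ ε, IsCompact (slab ε) := fun ε => slab_isCompact hU.continuousOn hK _
  have hGslab : ∀ ε, IntegrableOn G (slab ε) := fun ε =>
    (hG.mono (sep_subset _ _)).integrableOn_compact (hslabc ε)
  choose! r hr c hc B hB hr𝒰 hfr hGB hBc hvol using fun p (hp : p ∈ S) =>
    exists_ball_slab_le h𝒰 hU hG hG0 hS hreg hκ0 hp.1 hp.2
  have hlocal : ∀ p ∈ S, ∀ D ⊆ ball p (r p), MeasurableSet D → ν (frontier D) = 0 → ∀ σ > 0,
      ∀ᶠ ε in 𝓝[>] (0 : ℝ), ∫ x in slab ε ∩ D, G x ≤ ε * ((∫ x in D, (g x + κ) ∂ν) + σ) := by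
    intro p hp D hDr hD hDf σ hσ
    have hclos : ν (closure D) = ν D := by
      refine le_antisymm ?_ (measure_mono subset_closure)
      rw [closure_eq_self_union_frontier]
      exact (measure_union_le _ _).trans (by rw [hDf, add_zero])
    have hlim : Tendsto (fun ε => B p / c p * ν.real (cthickening (ε / c p) D)) (𝓝[>] 0)
        (𝓝 (B p / c p * ν.real D)) := by
      refine Tendsto.const_mul _ ?_
      have h1 := tendsto_measure_cthickening (μ := ν) (s := D) ⟨1, one_pos, measure_ne_top _ _⟩
      rw [hclos] at h1
      have h2 := (ENNReal.tendsto_toReal (measure_ne_top ν D)).comp h1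
      refine h2.comp (Tendsto.mono_left ?_ nhdsWithin_le_nhds)
      have : Tendsto (fun ε : ℝ => ε / c p) (𝓝 0) (𝓝 (0 / c p)) := tendsto_id.div_const _
      rwa [zero_div] at this
    have hDint : B p / c p * ν.real D ≤ ∫ x in D, (g x + κ) ∂ν := by
      have : ∫ _x in D, B p / c p ∂ν = B p / c p * ν.real D := by
        rw [setIntegral_const, smul_eq_mul, mul_comm]
      rw [← this]
      exact setIntegral_mono_on (integrable_const _) hgκ.integrableOn hD
        fun x hx => hBc p hp x (hDr hx)
    have hsmall : ∀ᶠ ε in 𝓝[>] (0 : ℝ), 0 < ε ∧ ε < c p * r p :=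
      Ioo_mem_nhdsGT (mul_pos (hc p hp) (hr p hp))
    filter_upwards [hlim.eventually_lt_const (lt_add_of_pos_right _ hσ), hsmall] with ε h1 h2
    have hAm : MeasurableSet (slab ε ∩ D) := (hslabc ε).measurableSet.inter hD
    have hv := hvol p hp ε h2.1 ((div_lt_iff₀' (hc p hp)).2 h2.2) (slab ε ∩ D) hAm
      (inter_subset_right.trans hDr) (fun x hx => hx.1.2)
    have hv2 : volume (slab ε ∩ D) ≤
        ENNReal.ofReal (ε / c p) * ν (cthickening (ε / c p) D) := hv.trans (by
      gcongr
      exact cthickening_subset_of_subset _ inter_subset_right)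
    have hv3 : volume.real (slab ε ∩ D) ≤ ε / c p * ν.real (cthickening (ε / c p) D) := by
      have := ENNReal.toReal_mono (ENNReal.mul_ne_top ENNReal.ofReal_ne_top
        (measure_ne_top _ _)) hv2
      rwa [ENNReal.toReal_mul, ENNReal.toReal_ofReal (div_pos h2.1 (hc p hp)).le] at this
    have hfinA : volume (slab ε ∩ D) ≠ ⊤ :=
      ((measure_mono inter_subset_left).trans_lt (hslabc ε).measure_lt_top).ne
    calc ∫ x in slab ε ∩ D, G x ≤ ∫ _x in slab ε ∩ D, B p :=
          setIntegral_mono_on ((hGslab ε).mono_set inter_subset_left)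
            (integrableOn_const hfinA) hAm fun x hx => hGB p hp x (hDr hx.2)
      _ = B p * volume.real (slab ε ∩ D) := by rw [setIntegral_const, smul_eq_mul, mul_comm]
      _ ≤ B p * (ε / c p * ν.real (cthickening (ε / c p) D)) :=
          mul_le_mul_of_nonneg_left hv3 (hB p hp)
      _ = ε * (B p / c p * ν.real (cthickening (ε / c p) D)) := by ring
      _ ≤ ε * ((∫ x in D, (g x + κ) ∂ν) + σ) :=
          mul_le_mul_of_nonneg_left (h1.le.trans (by linarith)) h2.1.le
  have hfinite : ∀ t : Finset (Eucl (m + 1)), (∀ p ∈ t, p ∈ S) → ∀ D, MeasurableSet D →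
      ν (frontier D) = 0 → ∀ σ > 0, ∀ᶠ ε in 𝓝[>] (0 : ℝ),
        ∫ x in slab ε ∩ (D ∩ ⋃ p ∈ t, ball p (r p)), G x ≤
          ε * ((∫ x in D ∩ ⋃ p ∈ t, ball p (r p), (g x + κ) ∂ν) + σ) := by
    intro t
    induction t using Finset.induction_on with
    | empty =>
      intro _ D _ _ σ hσ
      filter_upwards [self_mem_nhdsWithin] with ε hε
      simpa using (mul_pos (mem_Ioi.1 hε) hσ).le
    | insert p t _ ih =>
      intro ht D hD hDf σ hσ
      have hpS := ht p (Finset.mem_insert_self p t)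
      set W := ⋃ q ∈ t, ball q (r q) with hW
      have hWm : MeasurableSet W := t.measurableSet_biUnion fun q _ => measurableSet_ball
      have hsplit : D ∩ ⋃ q ∈ insert p t, ball q (r q) =
          (D ∩ ball p (r p)) ∪ ((D \ ball p (r p)) ∩ W) := by
        rw [Finset.set_biUnion_insert]
        ext x
        simp only [mem_inter_iff, mem_union, Set.mem_sdiff]
        tauto
      have hdisj : Disjoint (D ∩ ball p (r p)) ((D \ ball p (r p)) ∩ W) :=
        disjoint_left.2 fun x hx hx' => hx'.1.2 hx.2
      have hf1 : ν (frontier (D ∩ ball p (r p))) = 0 :=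
        measure_mono_null ((frontier_inter_subset _ _).trans
          (union_subset_union inter_subset_left inter_subset_right))
          (measure_union_null hDf (hfr p hpS))
      have hf2 : ν (frontier (D \ ball p (r p))) = 0 := by
        rw [Set.sdiff_eq]
        refine measure_mono_null ((frontier_inter_subset _ _).trans
          (union_subset_union inter_subset_left inter_subset_right))
          (measure_union_null hDf ?_)
        rw [frontier_compl]
        exact hfr p hpS
      have hm1 := hD.inter (measurableSet_ball (x := p) (ε := r p))
      have hm2 := (hD.diff (measurableSet_ball (x := p) (ε := r p))).inter hWm
      filter_upwards [hlocal p hpS _ inter_subset_right hm1 hf1 (σ / 2) (half_pos hσ),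
        ih (fun q hq => ht q (Finset.mem_insert_of_mem hq)) _ (hD.diff measurableSet_ball) hf2
          (σ / 2) (half_pos hσ)] with ε h1 h2
      rw [hsplit, inter_union_distrib_left, setIntegral_union
        (hdisj.mono inter_subset_right inter_subset_right)
        ((hslabc ε).measurableSet.inter hm2) ((hGslab ε).mono_set inter_subset_left)
        ((hGslab ε).mono_set inter_subset_left),
        setIntegral_union hdisj hm2 hgκ.integrableOn hgκ.integrableOn]
      linarith
  obtain ⟨t, htS, hcov⟩ := hS.elim_nhds_subcover (fun p => ball p (r p))
    fun p hp => ball_mem_nhds p (hr p hp)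
  have hWo : IsOpen (⋃ p ∈ t, ball p (r p)) := isOpen_biUnion fun _ _ => isOpen_ball
  have hslabW : ∀ᶠ ε in 𝓝[>] (0 : ℝ), slab ε ⊆ ⋃ p ∈ t, ball p (r p) := by
    have hKW : IsCompact ({x ∈ 𝒰 | U x ≤ η} \ ⋃ p ∈ t, ball p (r p)) := hK.diff hWo
    rcases ({x ∈ 𝒰 | U x ≤ η} \ ⋃ p ∈ t, ball p (r p)).eq_empty_or_nonempty with h0 | hne
    · exact Eventually.of_forall fun ε x hx => sdiff_eq_empty.1 h0 ⟨hx.1, hx.2.2⟩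
    · obtain ⟨z, hz, hzmax⟩ := hKW.exists_isMaxOn hne
        (hU.continuousOn.mono fun x hx => hx.1.1)
      have hzη : U z < η := lt_of_le_of_ne hz.1.2 fun h => hz.2 (hcov ⟨hz.1.1, h⟩)
      have hsmall : ∀ᶠ ε in 𝓝[>] (0 : ℝ), 0 < ε ∧ ε < η - U z := Ioo_mem_nhdsGT (by linarith)
      filter_upwards [hsmall] with ε hε x hx
      by_contra hxW
      have : U x ≤ U z := hzmax ⟨⟨hx.1, hx.2.2⟩, hxW⟩
      linarith [hx.2.1]
  obtain ⟨ε, ⟨⟨h1, h2⟩, h3⟩, hε⟩ := (((hM.and hslabW).and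
    (hfinite t htS univ MeasurableSet.univ (by simp) κ hκ0)).and self_mem_nhdsWithin).exists
  rw [univ_inter, inter_eq_left.2 h2] at h3
  have h4 := le_of_mul_le_mul_left (h1.trans h3) hε
  have h5 : ∫ x in ⋃ p ∈ t, ball p (r p), (g x + κ) ∂ν ≤ ∫ x, (g x + κ) ∂ν := by
    refine setIntegral_le_integral hgκ ?_
    filter_upwards [hνS] with x hx
    exact add_nonneg (div_nonneg (hG0 x hx.1) (norm_nonneg _)) hκ0.le
  rw [integral_add hgint (integrable_const κ), integral_const, smul_eq_mul, mul_comm] at h5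
  linarith

open scoped Convolution

theorem continuous_pd {n : ℕ} {f : Eucl n → ℝ} (hf : ContDiff ℝ 1 f) (i : Fin n) :
    Continuous (pd f i) :=
  (hf.continuous_fderiv one_ne_zero).clm_apply continuous_const

theorem contDiff_pd {n : ℕ} {f : Eucl n → ℝ} (hf : ContDiff ℝ 2 f) (i : Fin n) :
    ContDiff ℝ 1 (pd f i) :=
  (hf.fderiv_right (m := 1) (by norm_num)).clm_apply contDiff_const

theorem tsupport_pd_subset {n : ℕ} (f : Eucl n → ℝ) (i : Fin n) :
    tsupport (pd f i) ⊆ tsupport f :=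
  tsupport_fderiv_apply_subset ℝ _

theorem HasCompactSupport.pd {n : ℕ} {f : Eucl n → ℝ} (hf : HasCompactSupport f) (i : Fin n) :
    HasCompactSupport (pd f i) :=
  hf.fderiv_apply ℝ _

theorem pd2_eq_pd_pd {n : ℕ} (f : Eucl n → ℝ) (i j : Fin n) : pd2 f i j = pd (pd f j) i := rfl

theorem Lop_eq_zero_of_notMem_tsupport {n : ℕ} (a : Eucl n → Matrix (Fin n) (Fin n) ℝ)
    (V : Eucl n → Fin n → ℝ) {f : Eucl n → ℝ} {x : Eucl n} (hx : x ∉ tsupport f) :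
    Lop a V f x = 0 := by
  have h1 : ∀ i, pd f i x = 0 := fun i =>
    image_eq_zero_of_notMem_tsupport fun h => hx (tsupport_pd_subset f i h)
  have h2 : ∀ i j, pd2 f i j x = 0 := fun i j => by
    rw [pd2_eq_pd_pd]
    exact image_eq_zero_of_notMem_tsupport fun h =>
      hx (tsupport_pd_subset f j (tsupport_pd_subset _ i h))
  simp [Lop, h1, h2]

theorem continuousOn_Lop {n : ℕ} {𝒰 : Set (Eucl n)} {a : Eucl n → Matrix (Fin n) (Fin n) ℝ}
    {V : Eucl n → Fin n → ℝ} (ha : ∀ i j, ContinuousOn (fun x => a x i j) 𝒰)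
    (hV : ContinuousOn V 𝒰) {f : Eucl n → ℝ} (hf : ContDiff ℝ 2 f) :
    ContinuousOn (Lop a V f) 𝒰 := by
  have h1 : ∀ i, Continuous (pd f i) := continuous_pd (hf.of_le (by norm_num))
  have h2 : ∀ i j, Continuous (pd2 f i j) := fun i j => continuous_pd (contDiff_pd hf j) i
  refine ContinuousOn.add (continuousOn_finsetSum _ fun i _ => continuousOn_finsetSum _ fun j _ =>
    (ha i j).mul (h2 i j).continuousOn) (continuousOn_finsetSum _ fun i _ =>
      ((continuousOn_pi.1 hV) i).mul (h1 i).continuousOn)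

theorem integrableOn_Lop_mul {n : ℕ} {𝒰 : Set (Eucl n)} (h𝒰 : IsOpen 𝒰)
    {a : Eucl n → Matrix (Fin n) (Fin n) ℝ}
    {V : Eucl n → Fin n → ℝ} (ha : ∀ i j, ContinuousOn (fun x => a x i j) 𝒰)
    (hV : ContinuousOn V 𝒰) {u : Eucl n → ℝ} (hu : ContinuousOn u 𝒰)
    {f : Eucl n → ℝ} (hf : ContDiff ℝ 2 f) (hfc : HasCompactSupport f) (hf𝒰 : tsupport f ⊆ 𝒰) :
    IntegrableOn (fun x => Lop a V f x * u x) 𝒰 := by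
  have h : IntegrableOn (fun x => Lop a V f x * u x) (tsupport f) :=
    (((continuousOn_Lop ha hV hf).mul hu).mono hf𝒰).integrableOn_compact hfc
  refine h.of_forall_sdiff_eq_zero h𝒰.measurableSet fun x hx => ?_
  rw [Lop_eq_zero_of_notMem_tsupport a V hx.2, zero_mul]

theorem pd_convolution {n : ℕ} {φ f : Eucl n → ℝ} (hφ : LocallyIntegrable φ)
    (hf : ContDiff ℝ 1 f) (hfc : HasCompactSupport f) (i : Fin n) :
    pd (φ ⋆[ContinuousLinearMap.lsmul ℝ ℝ, volume] f) i =
      φ ⋆[ContinuousLinearMap.lsmul ℝ ℝ, volume] pd f i := by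
  ext x
  rw [pd, (hfc.hasFDerivAt_convolution_right _ hφ hf x).fderiv,
    convolution_precompR_apply _ hφ (hfc.fderiv ℝ) (hf.continuous_fderiv one_ne_zero)]
  rfl

/-- A compactly supported `C²` function can be approximated by smooth functions, uniformly with its
derivatives of order one and two, keeping supports under control. -/
theorem exists_smooth_approx {n : ℕ} {f : Eucl n → ℝ} (hf : ContDiff ℝ 2 f)
    (hfc : HasCompactSupport f) {R ε : ℝ} (hR : 0 < R) (hε : 0 < ε) :
    ∃ g : Eucl n → ℝ, ContDiff ℝ (⊤ : ℕ∞) g ∧ tsupport g ⊆ cthickening R (tsupport f) ∧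
      (∀ i x, |pd g i x - pd f i x| ≤ ε) ∧ ∀ i j x, |pd2 g i j x - pd2 f i j x| ≤ ε := by
  have hf1 : ContDiff ℝ 1 f := hf.of_le (by norm_num)
  have hunif : ∀ h : Eucl n → ℝ, Continuous h → HasCompactSupport h →
      ∀ᶠ r in 𝓝[>] (0 : ℝ), ∀ x y, dist y x < r → dist (h y) (h x) ≤ ε := by
    intro h hc hs
    obtain ⟨r, hr, H⟩ := Metric.uniformContinuous_iff.1 (hc.uniformContinuous_of_tendsto_cocompact
      hs.is_zero_at_infty) ε hε
    filter_upwards [Ioo_mem_nhdsGT hr] with s hs x y hxy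
    exact (H (hxy.trans hs.2)).le
  have e1 := eventually_all.2 fun i => hunif _ (continuous_pd hf1 i) (hfc.pd i)
  have e2 := eventually_all.2 fun i => eventually_all.2 fun j =>
    hunif _ (continuous_pd (contDiff_pd hf j) i) ((hfc.pd j).pd i)
  obtain ⟨r, ⟨⟨h1, h2⟩, hrR⟩⟩ := ((e1.and e2).and (Ioo_mem_nhdsGT hR)).exists
  let φ : ContDiffBump (0 : Eucl n) := ⟨r / 2, r, half_pos hrR.1, half_lt_self hrR.1⟩
  have hφ : LocallyIntegrable (φ.normed volume) := φ.integrable_normed.locallyIntegrable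
  have hconv : ∀ h : Eucl n → ℝ, Continuous h → (∀ x y, dist y x < r → dist (h y) (h x) ≤ ε) →
      ∀ x, |(φ.normed volume ⋆[ContinuousLinearMap.lsmul ℝ ℝ, volume] h) x - h x| ≤ ε := by
    intro h hc H x
    exact φ.dist_normed_convolution_le hc.aestronglyMeasurable fun y hy => H x y hy
  refine ⟨φ.normed volume ⋆[ContinuousLinearMap.lsmul ℝ ℝ, volume] f, ?_, ?_, ?_, ?_⟩
  · exact φ.hasCompactSupport_normed.contDiff_convolution_left _ φ.contDiff_normed
      hf.continuous.locallyIntegrable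
  · refine closure_minimal ?_ isClosed_cthickening
    refine (support_convolution_subset _).trans ?_
    rintro _ ⟨x, hx, y, hy, rfl⟩
    rw [φ.support_normed_eq, mem_ball_zero_iff] at hx
    refine mem_cthickening_of_dist_le _ y _ _ (subset_tsupport _ hy) ?_
    simp only [dist_eq_norm, add_sub_cancel_right]
    exact hx.le.trans hrR.2.le
  · intro i x
    rw [pd_convolution hφ hf1 hfc]
    exact hconv _ (continuous_pd hf1 i) (h1 i) x
  · intro i j x
    rw [pd2_eq_pd_pd, pd2_eq_pd_pd, pd_convolution hφ hf1 hfc,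
      pd_convolution hφ (contDiff_pd hf j) (hfc.pd j)]
    exact hconv _ (continuous_pd (contDiff_pd hf j) i) (h2 i j) x

/-- The weak stationary equation extends from smooth to `C²` test functions. -/
theorem integral_Lop_mul_eq_zero {n : ℕ} {𝒰 : Set (Eucl n)} (h𝒰 : IsOpen 𝒰)
    {a : Eucl n → Matrix (Fin n) (Fin n) ℝ}
    {V : Eucl n → Fin n → ℝ} (ha : ∀ i j, ContinuousOn (fun x => a x i j) 𝒰)
    (hV : ContinuousOn V 𝒰) {u : Eucl n → ℝ} (hu : ContinuousOn u 𝒰) (huint : IntegrableOn u 𝒰)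
    (hstat : ∀ f : Eucl n → ℝ, ContDiff ℝ (⊤ : ℕ∞) f → HasCompactSupport f →
      tsupport f ⊆ 𝒰 → (∫ x in 𝒰, Lop a V f x * u x) = 0)
    {f : Eucl n → ℝ} (hf : ContDiff ℝ 2 f) (hfc : HasCompactSupport f) (hf𝒰 : tsupport f ⊆ 𝒰) :
    ∫ x in 𝒰, Lop a V f x * u x = 0 := by
  obtain ⟨R, hR, hR𝒰⟩ := hfc.isCompact.exists_cthickening_subset_open h𝒰 hf𝒰
  set K := cthickening R (tsupport f) with hK
  have hKc : IsCompact K := hfc.isCompact.cthickening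
  choose Ca hCa using fun i j => hKc.exists_bound_of_continuousOn ((ha i j).mono hR𝒰)
  choose CV hCV using fun i =>
    hKc.exists_bound_of_continuousOn (((continuousOn_pi.1 hV) i).mono hR𝒰)
  set C := (∑ i, ∑ j, |Ca i j|) + ∑ i, |CV i| with hC
  have hC0 : 0 ≤ C := by positivity
  have key : ∀ ε > 0, |∫ x in 𝒰, Lop a V f x * u x| ≤ ε * (C * ∫ x in 𝒰, |u x|) := by
    intro ε hε
    obtain ⟨g, hg, hgs, hg1, hg2⟩ := exists_smooth_approx hf hfc hR hε
    have hgc : HasCompactSupport g := hKc.of_isClosed_subset (isClosed_tsupport g) hgs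
    have hg2' : ContDiff ℝ 2 g := by exact_mod_cast contDiff_infty.1 hg 2
    have hdiff : ∀ x, |Lop a V f x - Lop a V g x| ≤ ε * C := by
      intro x
      by_cases hx : x ∈ K
      · have : Lop a V f x - Lop a V g x =
            (∑ i, ∑ j, a x i j * (pd2 f i j x - pd2 g i j x)) +
              ∑ i, V x i * (pd f i x - pd g i x) := by
          simp only [Lop, mul_sub, Finset.sum_sub_distrib]
          ring
        rw [this, hC, mul_add, Finset.mul_sum, Finset.mul_sum]
        refine (abs_add_le _ _).trans (add_le_add ?_ ?_)
        · refine (Finset.abs_sum_le_sum_abs _ _).trans (Finset.sum_le_sum fun i _ => ?_)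
          rw [Finset.mul_sum]
          refine (Finset.abs_sum_le_sum_abs _ _).trans (Finset.sum_le_sum fun j _ => ?_)
          rw [abs_mul, mul_comm, abs_sub_comm]
          exact mul_le_mul (hg2 i j x) ((hCa i j x hx).trans (le_abs_self _)) (abs_nonneg _) hε.le
        · refine (Finset.abs_sum_le_sum_abs _ _).trans (Finset.sum_le_sum fun i _ => ?_)
          rw [abs_mul, mul_comm, abs_sub_comm]
          exact mul_le_mul (hg1 i x) ((hCV i x hx).trans (le_abs_self _)) (abs_nonneg _) hε.le
      · rw [Lop_eq_zero_of_notMem_tsupport a V fun h => hx (hgs h),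
          Lop_eq_zero_of_notMem_tsupport a V fun h => hx (self_subset_cthickening _ h), sub_zero,
          abs_zero]
        positivity
    have hsub : ∫ x in 𝒰, Lop a V f x * u x =
        ∫ x in 𝒰, (Lop a V f x * u x - Lop a V g x * u x) := by
      rw [integral_sub (integrableOn_Lop_mul h𝒰 ha hV hu hf hfc hf𝒰)
        (integrableOn_Lop_mul h𝒰 ha hV hu hg2' hgc (hgs.trans hR𝒰)),
        hstat g hg hgc (hgs.trans hR𝒰), sub_zero]
    rw [hsub, ← mul_assoc, ← integral_const_mul, ← Real.norm_eq_abs]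
    refine norm_integral_le_of_norm_le (huint.abs.const_mul _) (Eventually.of_forall fun x => ?_)
    rw [← sub_mul, Real.norm_eq_abs, abs_mul]
    exact mul_le_mul_of_nonneg_right (hdiff x) (abs_nonneg _)
  have hlim : Tendsto (fun ε : ℝ => ε * (C * ∫ x in 𝒰, |u x|)) (𝓝[>] 0) (𝓝 0) := by
    have : Tendsto (fun ε : ℝ => ε * (C * ∫ x in 𝒰, |u x|)) (𝓝 0)
        (𝓝 (0 * (C * ∫ x in 𝒰, |u x|))) := tendsto_id.mul_const _
    rw [zero_mul] at this
    exact this.mono_left nhdsWithin_le_nhds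
  have h0 : |∫ x in 𝒰, Lop a V f x * u x| ≤ 0 :=
    ge_of_tendsto hlim (eventually_mem_nhdsWithin.mono key)
  exact abs_nonpos_iff.1 h0

/-- Chain rule `ℒ(φ ∘ U) = φ'(U) ℒU + φ''(U) ⟨a∇U, ∇U⟩`. -/
theorem Lop_comp {n : ℕ} {𝒰 : Set (Eucl n)} (h𝒰 : IsOpen 𝒰)
    (a : Eucl n → Matrix (Fin n) (Fin n) ℝ) (V : Eucl n → Fin n → ℝ) {U : Eucl n → ℝ}
    (hU : ContDiffOn ℝ 2 U 𝒰) {φ : ℝ → ℝ} (hφ : ContDiff ℝ 2 φ) {f : Eucl n → ℝ}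
    (hf : ∀ x ∈ 𝒰, f x = φ (U x)) {x : Eucl n} (hx : x ∈ 𝒰) :
    Lop a V f x = deriv φ (U x) * Lop a V U x + deriv (deriv φ) (U x) * aQuad a U x := by
  have hφ' : ContDiff ℝ 1 (deriv φ) := hφ.deriv'
  have hUd : ∀ y ∈ 𝒰, DifferentiableAt ℝ U y := fun y hy =>
    (hU.contDiffAt (h𝒰.mem_nhds hy)).differentiableAt two_ne_zero
  have h1 : ∀ i, ∀ y ∈ 𝒰, pd f i y = deriv φ (U y) * pd U i y := by
    intro i y hy
    have he : f =ᶠ[𝓝 y] fun z => φ (U z) := eventually_of_mem (h𝒰.mem_nhds hy) hf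
    have hd : HasFDerivAt (fun z => φ (U z)) (deriv φ (U y) • fderiv ℝ U y) y :=
      ((hφ.differentiable two_ne_zero) (U y)).hasDerivAt.comp_hasFDerivAt y (hUd y hy).hasFDerivAt
    rw [pd, he.fderiv_eq, hd.fderiv]
    rfl
  have h2 : ∀ i j, pd2 f i j x =
      deriv φ (U x) * pd2 U i j x + deriv (deriv φ) (U x) * (pd U i x * pd U j x) := by
    intro i j
    have he : pd f j =ᶠ[𝓝 x] fun z => deriv φ (U z) * pd U j z :=
      eventually_of_mem (h𝒰.mem_nhds hx) (h1 j)
    have hd1 : HasFDerivAt (fun z => deriv φ (U z))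
        (deriv (deriv φ) (U x) • fderiv ℝ U x) x :=
      ((hφ'.differentiable one_ne_zero) (U x)).hasDerivAt.comp_hasFDerivAt x
        (hUd x hx).hasFDerivAt
    have hd2 : DifferentiableAt ℝ (pd U j) x :=
      (((hU.contDiffAt (h𝒰.mem_nhds hx)).fderiv_right (m := 1) (by norm_num)).clm_apply
        contDiffAt_const).differentiableAt one_ne_zero
    have hm : HasFDerivAt (fun z => deriv φ (U z) * pd U j z)
        (deriv φ (U x) • fderiv ℝ (pd U j) x +
          pd U j x • (deriv (deriv φ) (U x) • fderiv ℝ U x)) x := hd1.mul hd2.hasFDerivAt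
    rw [pd2_eq_pd_pd, pd2_eq_pd_pd, pd, he.fderiv_eq, hm.fderiv]
    simp only [add_apply, smul_apply, smul_eq_mul]
    rw [show pd (pd U j) i x = fderiv ℝ (pd U j) x (EuclideanSpace.single i 1) from rfl,
      show pd U i x = fderiv ℝ U x (EuclideanSpace.single i 1) from rfl]
    ring
  simp only [Lop, aQuad, h1 _ x hx, h2, mul_add, Finset.sum_add_distrib, Finset.mul_sum]
  have e1 : ∀ i j, a x i j * (deriv φ (U x) * pd2 U i j x) =
      deriv φ (U x) * (a x i j * pd2 U i j x) := fun i j => by ring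
  have e2 : ∀ i j, a x i j * (deriv (deriv φ) (U x) * (pd U i x * pd U j x)) =
      deriv (deriv φ) (U x) * (a x i j * pd U i x * pd U j x) := fun i j => by ring
  have e3 : ∀ i, V x i * (deriv φ (U x) * pd U i x) =
      deriv φ (U x) * (V x i * pd U i x) := fun i => by ring
  simp only [e1, e2, e3]
  ring

/-- A `C²` cutoff profile whose derivative climbs with slope at most one on `[α, β]`, stays above
`I` on `[β, η₁]`, and then decreases to zero before `η₂`. -/
theorem exists_cutoff {α β η₁ η₂ I : ℝ} (hI0 : 0 < I) (hI : I < β - α)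
    (h2 : η₁ < η₂) :
    ∃ φ : ℝ → ℝ, ContDiff ℝ 2 φ ∧ (∀ t, η₂ ≤ t → φ t = 0) ∧ (∀ t, 0 ≤ deriv φ t) ∧
      (∀ t ≤ α, deriv φ t = 0) ∧ (∀ t, β ≤ t → t ≤ η₁ → I ≤ deriv φ t) ∧
      (∀ t, deriv (deriv φ) t ≤ 1) ∧ ∀ t, t ≤ α ∨ β ≤ t → deriv (deriv φ) t ≤ 0 := by
  set s := (β - α - I) / 2 with hs
  obtain ⟨θ, hθ0, hθ1, hθ⟩ := exists_continuous_zero_one_of_isClosed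
    (isClosed_Iic.union isClosed_Ici : IsClosed (Iic α ∪ Ici β))
    (isClosed_Icc : IsClosed (Icc (α + s) (β - s))) (disjoint_left.2 fun t ht ht' => by
      rcases ht with ht | ht
      · linarith [mem_Iic.1 ht, ht'.1]
      · linarith [mem_Ici.1 ht, ht'.2])
  have hθi : ∀ x y, IntervalIntegrable θ volume x y := fun x y =>
    θ.continuous.intervalIntegrable x y
  set ψ₁ := fun t => ∫ r in α..t, θ r with hψ₁
  have hd₁ : ∀ t, HasDerivAt ψ₁ (θ t) t := fun t =>
    intervalIntegral.integral_hasDerivAt_right (hθi _ _)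
      (θ.continuous.stronglyMeasurableAtFilter _ _) θ.continuous.continuousAt
  have hψ₁C : ContDiff ℝ 1 ψ₁ := contDiff_one_iff_deriv.2
    ⟨fun t => (hd₁ t).differentiableAt, by
      rw [show deriv ψ₁ = θ from funext fun t => (hd₁ t).deriv]; exact θ.continuous⟩
  have hψ₁low : ∀ t ≤ α, ψ₁ t = 0 := fun t ht => by
    rw [hψ₁]
    simp only
    rw [intervalIntegral.integral_symm, neg_eq_zero]
    refine (intervalIntegral.integral_congr (g := fun _ => (0 : ℝ)) fun r hr => ?_).trans (by simp)
    rw [uIcc_of_le ht] at hr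
    exact hθ0 (Or.inl hr.2)
  have hmono : Monotone ψ₁ := monotone_of_deriv_nonneg (fun t => (hd₁ t).differentiableAt)
    fun t => by rw [(hd₁ t).deriv]; exact (hθ t).1
  have hψ₁0 : ∀ t, 0 ≤ ψ₁ t := fun t => by
    rcases le_total t α with h | h
    · exact (hψ₁low t h).ge
    · exact (hψ₁low α le_rfl).symm.trans_le (hmono h)
  have hψ₁I : ∀ t, β ≤ t → I ≤ ψ₁ t := fun t ht => by
    have e : ψ₁ (β - s) - ψ₁ (α + s) = I := by
      rw [hψ₁]
      simp only
      rw [intervalIntegral.integral_interval_sub_left (hθi _ _) (hθi _ _)]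
      rw [intervalIntegral.integral_congr (g := fun _ => (1 : ℝ)) fun r hr => ?_]
      · simp only [intervalIntegral.integral_const, smul_eq_mul, mul_one, hs]
        ring
      · rw [uIcc_of_le (by rw [hs]; linarith)] at hr
        exact hθ1 hr
    have := hmono (show β - s ≤ t by rw [hs]; linarith)
    linarith [hψ₁0 (α + s)]
  set D := fun t => Real.smoothTransition ((η₂ - t) / (η₂ - η₁)) with hD
  have h12 : 0 < η₂ - η₁ := by linarith
  have hDC : ContDiff ℝ 1 D := by
    have : ContDiff ℝ 1 Real.smoothTransition := Real.smoothTransition.contDiff (n := 1)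
    exact this.comp (by fun_prop)
  have hDanti : Antitone D := fun x y hxy => Real.smoothTransition.monotone (by gcongr)
  have hD' : ∀ t, deriv D t ≤ 0 := fun t => hDanti.deriv_nonpos
  set ψ := fun t => ψ₁ t * D t with hψ
  have hψC : ContDiff ℝ 1 ψ := hψ₁C.mul hDC
  have hdψ : ∀ t, deriv ψ t = θ t * D t + ψ₁ t * deriv D t := fun t =>
    ((hd₁ t).mul ((hDC.differentiable one_ne_zero) t).hasDerivAt).deriv
  have hψhigh : ∀ t, η₂ ≤ t → ψ t = 0 := fun t ht => by
    have : D t = 0 := Real.smoothTransition.zero_of_nonpos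
      (div_nonpos_of_nonpos_of_nonneg (by linarith) h12.le)
    simp only [hψ, this, mul_zero]
  have hdψle : ∀ t, deriv ψ t ≤ θ t := fun t => by
    rw [hdψ]
    have i1 := mul_le_mul_of_nonneg_left (Real.smoothTransition.le_one ((η₂ - t) / (η₂ - η₁)))
      (hθ t).1
    have i2 := mul_nonpos_of_nonneg_of_nonpos (hψ₁0 t) (hD' t)
    simp only [hD] at i1 i2 ⊢
    linarith
  set φ := fun t => ∫ r in η₂..t, ψ r with hφ
  have hdφ : ∀ t, HasDerivAt φ (ψ t) t := fun t =>
    intervalIntegral.integral_hasDerivAt_right (hψC.continuous.intervalIntegrable _ _)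
      (hψC.continuous.stronglyMeasurableAtFilter _ _) hψC.continuous.continuousAt
  have hdφ' : deriv φ = ψ := funext fun t => (hdφ t).deriv
  refine ⟨φ, ?_, ?_, ?_, ?_, ?_, ?_, ?_⟩
  · rw [show (2 : WithTop ℕ∞) = 1 + 1 by norm_num, contDiff_succ_iff_deriv, hdφ']
    exact ⟨fun t => (hdφ t).differentiableAt, by simp, hψC⟩
  · intro t ht
    refine (intervalIntegral.integral_congr (g := fun _ => (0 : ℝ)) fun r hr => ?_).trans (by simp)
    rw [uIcc_of_le ht] at hr
    exact hψhigh r hr.1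
  · intro t
    rw [hdφ']
    exact mul_nonneg (hψ₁0 t) (Real.smoothTransition.nonneg _)
  · intro t ht
    rw [hdφ']
    simp only [hψ, hψ₁low t ht, zero_mul]
  · intro t ht ht'
    have : D t = 1 := Real.smoothTransition.one_of_one_le ((one_le_div h12).2 (by linarith))
    rw [hdφ']
    simp only [hψ, this, mul_one]
    exact hψ₁I t ht
  · intro t
    rw [hdφ']
    exact (hdψle t).trans (hθ t).2
  · intro t ht
    rw [hdφ']
    exact (hdψle t).trans (hθ0 ht).le

/-- If `φ` vanishes on `[ρ, ∞)` and the sublevel set `U ≤ ρ` is compact in `𝒰`, then the extension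
of `φ ∘ U` by zero is a compactly supported `C²` function. -/
theorem contDiff_indicator_comp {n : ℕ} {𝒰 : Set (Eucl n)} (h𝒰 : IsOpen 𝒰) {U : Eucl n → ℝ}
    (hU : ContDiffOn ℝ 2 U 𝒰) {φ : ℝ → ℝ} (hφ : ContDiff ℝ 2 φ) {ρ : ℝ}
    (hφ0 : ∀ t, ρ ≤ t → φ t = 0) (hK : IsCompact {x ∈ 𝒰 | U x ≤ ρ}) :
    ContDiff ℝ 2 (𝒰.indicator fun x => φ (U x)) ∧
      tsupport (𝒰.indicator fun x => φ (U x)) ⊆ {x ∈ 𝒰 | U x ≤ ρ} := by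
  have hout : ∀ x ∉ {x ∈ 𝒰 | U x ≤ ρ}, 𝒰.indicator (fun x => φ (U x)) x = 0 := by
    intro x hx
    by_cases hx𝒰 : x ∈ 𝒰
    · rw [indicator_of_mem hx𝒰]
      exact hφ0 _ (le_of_not_ge fun h => hx ⟨hx𝒰, h⟩)
    · exact indicator_of_notMem hx𝒰 _
  refine ⟨contDiff_iff_contDiffAt.2 fun x => ?_, closure_minimal
    (fun x hx => by_contra fun h => hx (hout x h)) hK.isClosed⟩
  by_cases hx : x ∈ 𝒰
  · refine (hφ.contDiffAt.comp x (hU.contDiffAt (h𝒰.mem_nhds hx))).congr_of_eventuallyEq ?_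
    filter_upwards [h𝒰.mem_nhds hx] with y hy
    exact indicator_of_mem hy _
  · refine (contDiffAt_const (c := (0 : ℝ))).congr_of_eventuallyEq ?_
    filter_upwards [hK.isClosed.isOpen_compl.mem_nhds fun h : x ∈ {x ∈ 𝒰 | U x ≤ ρ} => hx h.1]
      with y hy
    exact hout y hy

/-- The mass of `{η ≤ U < ηs}` is controlled by the integral of `⟨a∇U, ∇U⟩ u` over any slab
`{α ≤ U ≤ η}` lying in the region where the Lyapunov inequality holds. -/
theorem mul_mass_le_slab {n : ℕ} {𝒰 : Set (Eucl n)} (h𝒰 : IsOpen 𝒰)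
    {a : Eucl n → Matrix (Fin n) (Fin n) ℝ} {V : Eucl n → Fin n → ℝ}
    (ha : ∀ i j, ContinuousOn (fun x => a x i j) 𝒰) (hV : ContinuousOn V 𝒰)
    {u : Eucl n → ℝ} (hu : ContinuousOn u 𝒰) (hu0 : ∀ x ∈ 𝒰, 0 ≤ u x) (huint : IntegrableOn u 𝒰)
    (hstat : ∀ f : Eucl n → ℝ, ContDiff ℝ (⊤ : ℕ∞) f → HasCompactSupport f →
      tsupport f ⊆ 𝒰 → (∫ x in 𝒰, Lop a V f x * u x) = 0)
    {U : Eucl n → ℝ} (hU : ContDiffOn ℝ 2 U 𝒰) (hQ : ContinuousOn (aQuad a U) 𝒰)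
    (hQ0 : ∀ x ∈ 𝒰, 0 ≤ aQuad a U x)
    {γ α η ηs ρ : ℝ} (hγ : 0 < γ) (hαη : α < η) (hηs : η < ηs) (hρ : ηs < ρ)
    (hK : ∀ t ≤ ρ, IsCompact {x ∈ 𝒰 | U x ≤ t})
    (hLyap : ∀ x ∈ 𝒰, α < U x → Lop a V U x ≤ -γ) :
    γ * ((η - α) * ∫ x in {x ∈ 𝒰 | η ≤ U x ∧ U x < ηs}, u x) ≤
      ∫ x in {x ∈ 𝒰 | α ≤ U x ∧ U x ≤ η}, aQuad a U x * u x := by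
  set A := {x ∈ 𝒰 | η ≤ U x ∧ U x < ηs} with hA
  set S := {x ∈ 𝒰 | α ≤ U x ∧ U x ≤ η} with hS
  have hSc : IsCompact S := slab_isCompact hU.continuousOn (hK η (by linarith)) α
  have hAm : MeasurableSet A := by
    have := (slab_isCompact hU.continuousOn (hK ηs hρ.le) η).measurableSet.diff
      (slab_isCompact hU.continuousOn (hK ηs hρ.le) ηs).measurableSet
    convert this using 1
    ext x
    simp only [hA, Set.mem_sdiff, mem_ofPred_eq]
    constructor
    · rintro ⟨h1, h2, h3⟩
      exact ⟨⟨h1, h2, h3.le⟩, fun h => absurd h.2.1 (not_le.2 h3)⟩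
    · rintro ⟨⟨h1, h2, h3⟩, h4⟩
      exact ⟨h1, h2, not_le.1 fun h => h4 ⟨h1, h, h3⟩⟩
  have hGS : IntegrableOn (fun x => aQuad a U x * u x) S :=
    ((hQ.mul hu).mono (sep_subset _ _)).integrableOn_compact hSc
  have key : ∀ I, 0 < I → I < η - α →
      γ * I * (∫ x in A, u x) ≤ ∫ x in S, aQuad a U x * u x := by
    intro I hI0 hI
    obtain ⟨φ, hφ, hφ0, hφ1, hφlow, hφI, hφ2, hφ2'⟩ := exists_cutoff hI0 hI hρ
    obtain ⟨hf, hfs⟩ := contDiff_indicator_comp h𝒰 hU hφ hφ0 (hK ρ le_rfl)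
    set f := 𝒰.indicator fun x => φ (U x) with hfdef
    have hfc : HasCompactSupport f :=
      (hK ρ le_rfl).of_isClosed_subset (isClosed_tsupport f) hfs
    have hf𝒰 : tsupport f ⊆ 𝒰 := hfs.trans (sep_subset _ _)
    have h0 := integral_Lop_mul_eq_zero h𝒰 ha hV hu huint hstat hf hfc hf𝒰
    have hpt : ∀ x ∈ 𝒰, Lop a V f x * u x ≤
        S.indicator (fun x => aQuad a U x * u x) x - A.indicator (fun x => γ * I * u x) x := by
      intro x hx
      rw [Lop_comp h𝒰 a V hU hφ (fun y hy => indicator_of_mem hy _) hx, add_mul, sub_eq_neg_add]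
      refine add_le_add ?_ ?_
      · by_cases hxα : U x ≤ α
        · rw [hφlow _ hxα, indicator_of_notMem fun h : x ∈ A => by linarith [h.2.1]]
          simp
        · have hL := hLyap x hx (not_le.1 hxα)
          have h1 : deriv φ (U x) * Lop a V U x ≤ -(γ * deriv φ (U x)) := by
            have := mul_le_mul_of_nonneg_left hL (hφ1 (U x))
            linarith
          have h2 := mul_le_mul_of_nonneg_right h1 (hu0 x hx)
          refine h2.trans ?_
          by_cases hxA : x ∈ A
          · rw [indicator_of_mem hxA, neg_mul]
            have h3 := mul_le_mul_of_nonneg_left (hφI _ hxA.2.1 hxA.2.2.le) hγ.le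
            have h4 := mul_le_mul_of_nonneg_right h3 (hu0 x hx)
            linarith
          · rw [indicator_of_notMem hxA, neg_mul, neg_zero, neg_nonpos]
            exact mul_nonneg (mul_nonneg hγ.le (hφ1 _)) (hu0 x hx)
      · have hG0 := mul_nonneg (hQ0 x hx) (hu0 x hx)
        rw [mul_assoc]
        by_cases hxS : x ∈ S
        · rw [indicator_of_mem hxS]
          exact mul_le_of_le_one_left hG0 (hφ2 _)
        · rw [indicator_of_notMem hxS]
          refine mul_nonpos_of_nonpos_of_nonneg (hφ2' _ ?_) hG0
          by_contra! h
          exact hxS ⟨hx, h.1.le, h.2.le⟩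
    have hi1 : IntegrableOn (S.indicator fun x => aQuad a U x * u x) 𝒰 :=
      ((integrable_indicator_iff hSc.measurableSet).2 hGS).integrableOn
    have hi2 : IntegrableOn (A.indicator fun x => γ * I * u x) 𝒰 :=
      (huint.const_mul _).indicator hAm
    have hint := setIntegral_mono_on (integrableOn_Lop_mul h𝒰 ha hV hu hf hfc hf𝒰)
      (hi1.sub hi2) h𝒰.measurableSet hpt
    simp only [Pi.sub_apply] at hint
    rw [h0, integral_sub hi1 hi2, setIntegral_indicator hSc.measurableSet,
      setIntegral_indicator hAm, inter_eq_right.2 (sep_subset 𝒰 _),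
      inter_eq_right.2 (sep_subset 𝒰 _), integral_const_mul] at hint
    linarith
  have hlim : Tendsto (fun I => γ * I * ∫ x in A, u x) (𝓝[<] (η - α))
      (𝓝 (γ * (η - α) * ∫ x in A, u x)) := by
    have : Continuous fun I => γ * I * ∫ x in A, u x := by fun_prop
    exact (this.tendsto _).mono_left nhdsWithin_le_nhds
  rw [← mul_assoc]
  refine le_of_tendsto hlim ?_
  filter_upwards [Ioo_mem_nhdsLT (show 0 < η - α by linarith)] with I hI
  exact key I hI.1 hI.2

/-- Inequality (p120) in the proof of Theorem A(b). -/
theorem inequality_p120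
    {n : ℕ} (hn : 0 < n)
    (𝒰 : Set (Eucl n)) (hUopen : IsOpen 𝒰) (hUconn : IsConnected 𝒰)
    (a : Eucl n → Matrix (Fin n) (Fin n) ℝ)
    (ha_C1 : ∀ i j, ContDiffOn ℝ 1 (fun x => a x i j) 𝒰)
    (ha_symm : ∀ x ∈ 𝒰, ∀ i j, a x i j = a x j i)
    (ha_psd : ∀ x ∈ 𝒰, ∀ v : Fin n → ℝ, 0 ≤ ∑ i, ∑ j, a x i j * v i * v j)
    (V : Eucl n → Fin n → ℝ) (hV_cont : ContinuousOn V 𝒰)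
    (u : Eucl n → ℝ) (hu_C1 : ContDiffOn ℝ 1 u 𝒰) (hu_nonneg : ∀ x ∈ 𝒰, 0 ≤ u x)
    (hu_mass : (∫ x in 𝒰, u x) = 1)
    (hu_stat : ∀ f : Eucl n → ℝ, ContDiff ℝ (⊤ : ℕ∞) f → HasCompactSupport f →
      tsupport f ⊆ 𝒰 → (∫ x in 𝒰, Lop a V f x * u x) = 0)
    (U : Eucl n → ℝ) (ρM : EReal) (hU_C2 : ContDiffOn ℝ 2 U 𝒰)
    (hU_nonneg : ∀ x ∈ 𝒰, 0 ≤ U x)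
    (hU_lt : ∀ x ∈ 𝒰, (U x : EReal) < ρM)
    (hU_sup : ρM = ⨆ x : 𝒰, (U x.1 : EReal))
    (hU_cpt : ∀ ρ : ℝ, (ρ : EReal) < ρM → IsCompact {x ∈ 𝒰 | U x ≤ ρ})
    (ρm γ : ℝ) (hρm_pos : 0 < ρm) (hρm_lt : (ρm : EReal) < ρM) (hγ : 0 < γ)
    (hLyap : ∀ x ∈ 𝒰, x ∉ closure {y ∈ 𝒰 | U y < ρm} → Lop a V U x ≤ -γ)
    (H : ℝ → ℝ) (hH_meas : Measurable H)
    (hH_nonneg : ∀ t : ℝ, 0 ≤ t → (t : EReal) < ρM → 0 ≤ H t)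
    (hH_locbdd : ∀ ρ : ℝ, (ρ : EReal) < ρM → BddAbove (H '' Set.Icc 0 ρ))
    (hH_up : ∀ x ∈ 𝒰, aQuad a U x ≤ H (U x))
    (η ηs : ℝ) (hη1 : ρm < η) (hη2 : η < ηs) (hη3 : (ηs : EReal) < ρM)
    (hreg : ∀ x ∈ 𝒰, (U x = η ∨ U x = ηs) → gradient U x ≠ 0) :
    γ * (∫ x in {x ∈ 𝒰 | η ≤ U x ∧ U x < ηs}, u x) ≤
      H η * ∫ x in {x ∈ 𝒰 | U x = η}, u x / ‖gradient U x‖ ∂μH[(n : ℝ) - 1] := by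
  obtain ⟨m, rfl⟩ : ∃ m, n = m + 1 := ⟨n - 1, by omega⟩
  rw [show (((m + 1 : ℕ) : ℝ) - 1) = (m : ℝ) by push_cast; ring]
  have hU1 : ContDiffOn ℝ 1 U 𝒰 := hU_C2.of_le (by norm_num)
  have ha : ∀ i j, ContinuousOn (fun x => a x i j) 𝒰 := fun i j => (ha_C1 i j).continuousOn
  have hu := hu_C1.continuousOn
  have huint : IntegrableOn u 𝒰 := integrable_of_integral_eq_one hu_mass
  have hpd : ∀ i, ContinuousOn (pd U i) 𝒰 := fun i =>
    (hU1.continuousOn_fderiv_of_isOpen hUopen le_rfl).clm_apply continuousOn_const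
  have hQ : ContinuousOn (aQuad a U) 𝒰 :=
    continuousOn_finsetSum _ fun i _ => continuousOn_finsetSum _ fun j _ =>
      ((ha i j).mul (hpd i)).mul (hpd j)
  have hQ0 : ∀ x ∈ 𝒰, 0 ≤ aQuad a U x := fun x hx => ha_psd x hx _
  obtain ⟨ρ, hρ1, hρ2⟩ := EReal.lt_iff_exists_real_btwn.1 hη3
  have hρ : ηs < ρ := EReal.coe_lt_coe_iff.1 hρ1
  have hK : ∀ t ≤ ρ, IsCompact {x ∈ 𝒰 | U x ≤ t} := fun t ht =>
    hU_cpt t ((EReal.coe_le_coe_iff.2 ht).trans_lt hρ2)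
  have hregη : ∀ x ∈ 𝒰, U x = η → gradient U x ≠ 0 := fun x hx h => hreg x hx (Or.inl h)
  have hLyap' : ∀ x ∈ 𝒰, ρm < U x → Lop a V U x ≤ -γ := by
    refine fun x hx hxρ => hLyap x hx fun hcl => ?_
    have hnhds : ∀ᶠ y in 𝓝 x, ρm < U y :=
      (hU1.continuousOn.continuousAt (hUopen.mem_nhds hx)).eventually_const_lt hxρ
    obtain ⟨y, hy, hy'⟩ := mem_closure_iff_nhds.1 hcl _ hnhds
    exact lt_asymm hy hy'.2
  have hM := le_setIntegral_level hUopen hU1 (G := fun x => aQuad a U x * u x) (hQ.mul hu)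
    (fun x hx => mul_nonneg (hQ0 x hx) (hu_nonneg x hx)) (hK η (by linarith)) hregη
    (M := γ * ∫ x in {x ∈ 𝒰 | η ≤ U x ∧ U x < ηs}, u x) (by
      filter_upwards [Ioo_mem_nhdsGT (show 0 < η - ρm by linarith)] with ε hε
      have := mul_mass_le_slab hUopen ha hV_cont hu hu_nonneg huint hu_stat hU_C2 hQ hQ0 hγ
        (show η - ε < η by linarith [hε.1]) hη2 hρ hK
        fun x hx h => hLyap' x hx (by linarith [hε.2])
      rwa [sub_sub_cancel, mul_left_comm] at this)
  refine hM.trans ?_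
  have hS : IsCompact {x ∈ 𝒰 | U x = η} := by
    convert slab_isCompact hU1.continuousOn (hK η (by linarith)) η using 1
    ext x
    simp only [mem_ofPred_eq]
    exact and_congr_right fun _ => ⟨fun h => ⟨h.ge, h.le⟩, fun h => le_antisymm h.2 h.1⟩
  have hfin := hausdorffMeasure_level_lt_top hUopen hU1 hS hregη
  have hdiv : ∀ {F : Eucl (m + 1) → ℝ}, ContinuousOn F 𝒰 →
      IntegrableOn (fun x => F x / ‖gradient U x‖) {x ∈ 𝒰 | U x = η} μH[(m : ℝ)] := fun hF =>
    integrableOn_of_continuousOn_isCompact ((hF.mono (sep_subset _ _)).div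
      ((continuousOn_gradient hUopen hU1).mono (sep_subset _ _)).norm
      fun x hx => norm_ne_zero_iff.2 (hregη x hx.1 hx.2)) hS hfin
  rw [← integral_const_mul]
  refine setIntegral_mono_on (hdiv (hQ.mul hu)) ((hdiv hu).const_mul _) hS.measurableSet
    fun x hx => ?_
  rw [← mul_div_assoc]
  have h1 := hH_up x hx.1
  rw [hx.2] at h1
  have h2 := hu_nonneg x hx.1
  gcongr
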